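/- There exists a constant C > 0 such that for every smooth compactly supported divergence-free vector field v : ℝ³ → ℝ³, −∫_{ℝ³} ∂ᵢvⱼ ∂ᵢv_k ∂_k vⱼ dV ≤ C ‖v‖_{L³(ℝ³)} ‖Δv‖²_{L²(ℝ³)}. -/

import Mathlib

open MeasureTheory

noncomputable def pd (i : Fin 3) (f : EuclideanSpace ℝ (Fin 3) → ℝ)
    (x : EuclideanSpace ℝ (Fin 3)) : ℝ :=
  fderiv ℝ f x (EuclideanSpace.single i 1)

abbrev E3 := EuclideanSpace ℝ (Fin 3)

/-- smooth and compactly supported scalar functions -/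
def Good (f : E3 → ℝ) : Prop := ContDiff ℝ (⊤ : ℕ∞) f ∧ HasCompactSupport f

lemma Good.pd {f : E3 → ℝ} (hf : Good f) (i : Fin 3) : Good (pd i f) := by
  constructor
  · have h : ContDiff ℝ (⊤ : ℕ∞) (fderiv ℝ f) := hf.1.fderiv_right (by simp)
    exact h.clm_apply contDiff_const
  · exact hf.2.fderiv_apply (𝕜 := ℝ) _

lemma Good.mul {f g : E3 → ℝ} (hf : Good f) (hg : Good g) : Good (fun x => f x * g x) :=
  ⟨hf.1.mul hg.1, hf.2.mul_right⟩

lemma Good.sum {g : Fin 3 → E3 → ℝ} (hg : ∀ i, Good (g i)) : Good (fun x => ∑ i, g i x) := by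
  simp only [Fin.sum_univ_three]
  exact ⟨((hg 0).1.add (hg 1).1).add (hg 2).1, ((hg 0).2.add (hg 1).2).add (hg 2).2⟩

lemma Good.integrable {f : E3 → ℝ} (hf : Good f) : Integrable f :=
  hf.1.continuous.integrable_of_hasCompactSupport hf.2

lemma Good.memLp {f : E3 → ℝ} (hf : Good f) (p : ENNReal) : MemLp f p volume :=
  hf.1.continuous.memLp_of_hasCompactSupport hf.2

lemma Good.diff {f : E3 → ℝ} (hf : Good f) : Differentiable ℝ f :=
  hf.1.differentiable (by simp)

lemma ibp {f g : E3 → ℝ} (hf : Good f) (hg : Good g) (i : Fin 3) :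
    ∫ x, pd i f x * g x = - ∫ x, f x * pd i g x := by
  have := integral_mul_fderiv_eq_neg_fderiv_mul_of_integrable (μ := (volume : Measure E3))
    (f := f) (g := g) (v := EuclideanSpace.single i 1)
    ((hf.pd i).mul hg).integrable (hf.mul (hg.pd i)).integrable (hf.mul hg).integrable
    (fun x _ => hf.diff x) (fun x _ => hg.diff x)
  unfold pd
  rw [this, neg_neg]

lemma pd_mul {f g : E3 → ℝ} (hf : Good f) (hg : Good g) (i : Fin 3) (x : E3) :
    pd i (fun y => f y * g y) x = f x * pd i g x + g x * pd i f x := by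
  unfold pd
  rw [fderiv_fun_mul (hf.diff x) (hg.diff x)]
  simp

lemma pd_comm {f : E3 → ℝ} (hf : Good f) (i k : Fin 3) : pd i (pd k f) = pd k (pd i f) := by
  funext x
  have hd : DifferentiableAt ℝ (fderiv ℝ f) x :=
    (hf.1.fderiv_right (m := (⊤ : ℕ∞)) (by simp)).differentiable (by simp) x
  have h : ∀ a b : Fin 3, pd a (pd b f) x
      = fderiv ℝ (fderiv ℝ f) x (EuclideanSpace.single a 1) (EuclideanSpace.single b 1) := by
    intro a b
    change fderiv ℝ (fun y => fderiv ℝ f y (EuclideanSpace.single b 1)) x _ = _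
    rw [fderiv_clm_apply hd (by fun_prop)]
    simp
  rw [h, h]
  have hs : IsSymmSndFDerivAt ℝ f x :=
    hf.1.contDiffAt.isSymmSndFDerivAt (by simpa using (by exact_mod_cast le_top : ((2 : ℕ∞) : WithTop ℕ∞) ≤ ((⊤ : ℕ∞) : WithTop ℕ∞)))
  exact hs _ _

lemma hess_swap {f : E3 → ℝ} (hf : Good f) (i k : Fin 3) :
    ∫ x, pd i (pd i f) x * pd k (pd k f) x = ∫ x, pd i (pd k f) x ^ 2 := by
  rw [ibp (hf.pd i) ((hf.pd k).pd k), pd_comm (hf.pd k) i k]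
  have := ibp (hf.pd i) ((hf.pd k).pd i) k
  rw [← this, pd_comm hf k i]
  simp [pow_two]

lemma hess_le {f : E3 → ℝ} (hf : Good f) (a b : Fin 3) :
    ∫ x, pd a (pd b f) x ^ 2 ≤ ∫ x, (∑ i : Fin 3, pd i (pd i f) x) ^ 2 := by
  have h1 : ∫ x, (∑ i : Fin 3, pd i (pd i f) x) ^ 2
      = ∑ i : Fin 3, ∑ k : Fin 3, ∫ x, pd i (pd k f) x ^ 2 := by
    simp_rw [← hess_swap hf]
    have : ∀ i k : Fin 3, Integrable (fun x => pd i (pd i f) x * pd k (pd k f) x) :=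
      fun i k => (((hf.pd i).pd i).mul ((hf.pd k).pd k)).integrable
    simp_rw [← integral_finsetSum Finset.univ (fun k _ => this _ k)]
    rw [← integral_finsetSum]
    · congr 1
      funext x
      rw [pow_two, Finset.sum_mul_sum]
    · exact fun i _ => integrable_finsetSum _ (fun k _ => this i k)
  rw [h1]
  have h0 : ∀ i k : Fin 3, 0 ≤ ∫ x, pd i (pd k f) x ^ 2 :=
    fun i k => integral_nonneg fun x => sq_nonneg _
  exact (Finset.single_le_sum (f := fun k => ∫ x, pd a (pd k f) x ^ 2)
      (fun k _ => h0 a k) (Finset.mem_univ b)).trans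
    (Finset.single_le_sum (f := fun i => ∑ k : Fin 3, ∫ x, pd i (pd k f) x ^ 2)
      (fun i _ => Finset.sum_nonneg fun k _ => h0 i k) (Finset.mem_univ a))

lemma eLp2 {f : E3 → ℝ} (hf : Good f) {L : ℝ} (h : ∫ x, f x ^ 2 ≤ L) :
    eLpNorm f 2 volume ≤ ENNReal.ofReal (√L) := by
  rw [(hf.memLp 2).eLpNorm_eq_integral_rpow_norm (by simp) (by simp)]
  apply ENNReal.ofReal_le_ofReal
  rw [Real.sqrt_eq_rpow]
  simp only [ENNReal.toReal_ofNat, Real.rpow_ofNat, Real.norm_eq_abs, sq_abs]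
  rw [one_div]
  exact Real.rpow_le_rpow (integral_nonneg fun x => sq_nonneg _) h (by norm_num)

lemma norm_clm_le (l : E3 →L[ℝ] ℝ) :
    ‖l‖ ≤ ∑ i : Fin 3, ‖l (EuclideanSpace.single i 1)‖ := by
  refine l.opNorm_le_bound (Finset.sum_nonneg fun _ _ => norm_nonneg _) fun y => ?_
  have hy : y = ∑ i : Fin 3, y i • EuclideanSpace.single i (1 : ℝ) := by
    ext j
    fin_cases j <;> simp [Fin.sum_univ_three]
  conv_lhs => rw [hy]
  rw [map_sum, Finset.sum_mul]
  refine (norm_sum_le _ _).trans (Finset.sum_le_sum fun i _ => ?_)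
  rw [map_smul, norm_smul, mul_comm]
  gcongr
  exact PiLp.norm_apply_le y i

lemma fderiv_eLp2 {g : E3 → ℝ} (hg : Good g) {L : ℝ} (h : ∀ i, ∫ x, pd i g x ^ 2 ≤ L) :
    eLpNorm (fderiv ℝ g) 2 volume ≤ 3 * ENNReal.ofReal (√L) := by
  calc eLpNorm (fderiv ℝ g) 2 volume
      ≤ eLpNorm (∑ i : Fin 3, fun x => ‖pd i g x‖) 2 volume := by
        refine eLpNorm_mono_real fun x => ?_
        rw [Finset.sum_apply]
        exact norm_clm_le _
    _ ≤ ∑ i : Fin 3, eLpNorm (fun x => ‖pd i g x‖) 2 volume :=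
        eLpNorm_sum_le (fun i _ => ((hg.pd i).1.continuous.norm).aestronglyMeasurable)
          (by norm_num)
    _ ≤ ∑ _i : Fin 3, ENNReal.ofReal (√L) := by
        refine Finset.sum_le_sum fun i _ => ?_
        rw [eLpNorm_norm]
        exact eLp2 (hg.pd i) (h i)
    _ = _ := by simp

lemma sobolev : ∃ C : NNReal, ∀ g : E3 → ℝ, Good g →
    eLpNorm g 6 volume ≤ C * eLpNorm (fderiv ℝ g) 2 volume := by
  refine ⟨eLpNormLESNormFDerivOfEqInnerConst (volume : Measure E3) 2, fun g hg => ?_⟩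
  have := eLpNorm_le_eLpNorm_fderiv_of_eq_inner (volume : Measure E3) (u := g)
    (hg.1.of_le (by simp)) hg.2 (p := 2) (p' := 6) (by norm_num) (by simp)
    (by simp; norm_num)
  simpa using this

lemma holder {a b c : E3 → ℝ} (ha : Good a) (hb : Good b) (hc : Good c) :
    ENNReal.ofReal |∫ x, a x * (b x * c x)| ≤
      eLpNorm a 3 volume * (eLpNorm b 6 volume * eLpNorm c 2 volume) := by
  have t1 : ENNReal.HolderTriple 6 2 (3/2) := ⟨by
    rw [ENNReal.inv_div (by simp) (by simp)]
    rw [← ENNReal.toReal_eq_toReal_iff' (by simp) (by simp [ENNReal.div_eq_top])]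
    rw [ENNReal.toReal_add (by simp) (by simp)]
    simp; norm_num⟩
  have t2 : ENNReal.HolderTriple 3 (3/2) 1 := ⟨by
    rw [ENNReal.inv_div (by simp) (by simp)]
    rw [← ENNReal.toReal_eq_toReal_iff' (by simp [ENNReal.div_eq_top]) (by simp)]
    rw [ENNReal.toReal_add (by simp) (by simp [ENNReal.div_eq_top])]
    simp; norm_num⟩
  have h1 := eLpNorm_smul_le_mul_eLpNorm (p := 6) (q := 2) (r := 3/2) (μ := volume)
    (hc.1.continuous.aestronglyMeasurable (μ := volume))
    (hb.1.continuous.aestronglyMeasurable (μ := volume))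
  have h2 := eLpNorm_smul_le_mul_eLpNorm (p := 3) (q := 3/2) (r := 1) (μ := volume)
    ((hb.mul hc).1.continuous.aestronglyMeasurable (μ := volume))
    (ha.1.continuous.aestronglyMeasurable (μ := volume))
  have h3 : ENNReal.ofReal |∫ x, a x * (b x * c x)|
      ≤ eLpNorm (a • fun x => b x * c x) 1 volume := by
    rw [← Real.norm_eq_abs, ofReal_norm, eLpNorm_one_eq_lintegral_enorm]
    exact enorm_integral_le_lintegral_enorm _
  exact h3.trans (h2.trans (mul_le_mul_right h1 _))

lemma core : ∃ C : ℝ, 0 < C ∧ ∀ (a f h : E3 → ℝ) (N L : ℝ), Good a → Good f → Good h →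
    0 ≤ N → 0 ≤ L → eLpNorm a 3 volume ≤ ENNReal.ofReal N →
    ∫ x, (∑ i : Fin 3, pd i (pd i f) x) ^ 2 ≤ L →
    ∫ x, (∑ i : Fin 3, pd i (pd i h) x) ^ 2 ≤ L →
    ∀ k p q : Fin 3, |∫ x, a x * (pd k f x * pd p (pd q h) x)| ≤ C * N * L := by
  obtain ⟨C, hC⟩ := sobolev
  refine ⟨3 * C + 1, by positivity, ?_⟩
  intro a f h N L ha hf hh hN hL haN hfL hhL k p q
  have hH := holder ha (hf.pd k) ((hh.pd q).pd p)
  have e1 := (hC _ (hf.pd k)).trans (mul_le_mul_right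
    (fderiv_eLp2 (hf.pd k) (fun i => (hess_le hf i k).trans hfL)) _)
  have e2 := eLp2 ((hh.pd q).pd p) ((hess_le hh p q).trans hhL)
  have key : ENNReal.ofReal |∫ x, a x * (pd k f x * pd p (pd q h) x)| ≤
      ENNReal.ofReal (N * ((C * (3 * √L)) * √L)) := by
    refine hH.trans ((mul_le_mul' haN (mul_le_mul' e1 e2)).trans (le_of_eq ?_))
    rw [ENNReal.ofReal_mul hN, ENNReal.ofReal_mul (by positivity),
      ENNReal.ofReal_mul (by positivity), ENNReal.ofReal_mul (by positivity)]
    simp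
  have := (ENNReal.ofReal_le_ofReal_iff (by positivity)).1 key
  have hs := Real.mul_self_sqrt hL
  have : |∫ x, a x * (pd k f x * pd p (pd q h) x)| ≤ 3 * C * N * L := by
    calc _ ≤ _ := this
      _ = 3 * C * N * (√L * √L) := by ring
      _ = _ := by rw [hs]
  nlinarith [mul_nonneg hN hL]

lemma comp_good {v : E3 → E3} (hv : ContDiff ℝ (⊤ : ℕ∞) v) (hc : HasCompactSupport v)
    (j : Fin 3) : Good (fun y => v y j) := by
  refine ⟨?_, ?_⟩
  · exact (contDiff_piLp 2).1 hv j
  · exact hc.comp_left (g := fun z : E3 => z j) rfl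

/-- `−∫ ∂ᵢvⱼ ∂ᵢv_k ∂_k vⱼ ≤ C ‖v‖_{L³} ‖Δv‖²_{L²}`. -/
theorem trilinear_le_L3_laplacian_sq :
    ∃ C : ℝ, 0 < C ∧
      ∀ v : EuclideanSpace ℝ (Fin 3) → EuclideanSpace ℝ (Fin 3),
        ContDiff ℝ (⊤ : ℕ∞) v → HasCompactSupport v →
        (∀ x, ∑ i : Fin 3, pd i (fun y => v y i) x = 0) →
        -(∫ x, ∑ i : Fin 3, ∑ j : Fin 3, ∑ k : Fin 3,
            pd i (fun y => v y j) x * pd i (fun y => v y k) x * pd k (fun y => v y j) x)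
          ≤ C * (∫ x, ‖v x‖ ^ 3) ^ ((1 : ℝ) / 3)
              * (∫ x, ∑ j : Fin 3,
                  (∑ i : Fin 3, pd i (fun y => pd i (fun z => v z j) y) x) ^ 2) := by
  obtain ⟨C, hC, hcore⟩ := core
  refine ⟨54 * C, by positivity, fun v hv hc _ => ?_⟩
  set L := ∫ x, ∑ j : Fin 3,
    (∑ i : Fin 3, pd i (fun y => pd i (fun z => v z j) y) x) ^ 2 with hLdef
  set N := (∫ x, ‖v x‖ ^ 3) ^ ((1 : ℝ) / 3) with hNdef
  have hN : 0 ≤ N := Real.rpow_nonneg (integral_nonneg fun x => by positivity) _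
  have hL : 0 ≤ L := integral_nonneg fun x => Finset.sum_nonneg fun _ _ => sq_nonneg _
  have g : ∀ j, Good (fun y => v y j) := comp_good hv hc
  have gl : ∀ j, Good (fun x => ∑ i : Fin 3, pd i (pd i (fun z => v z j)) x) :=
    fun j => Good.sum fun i => ((g j).pd i).pd i
  have hlap : ∀ j, ∫ x, (∑ i : Fin 3, pd i (pd i (fun z => v z j)) x) ^ 2 ≤ L := by
    intro j
    have hint : ∀ j, Integrable
        (fun x => (∑ i : Fin 3, pd i (pd i (fun z => v z j)) x) ^ 2) := by
      intro j
      simpa [pow_two] using ((gl j).mul (gl j)).integrable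
    refine integral_mono (hint j) (integrable_finsetSum _ fun j _ => hint j) fun x => ?_
    exact Finset.single_le_sum
      (f := fun j => (∑ i : Fin 3, pd i (pd i (fun z => v z j)) x) ^ 2)
      (fun _ _ => sq_nonneg _) (Finset.mem_univ j)
  have hL3 : ∀ j, eLpNorm (fun y => v y j) 3 volume ≤ ENNReal.ofReal N := by
    intro j
    refine (eLpNorm_mono (g := v) fun x => PiLp.norm_apply_le (v x) j).trans ?_
    rw [(hv.continuous.memLp_of_hasCompactSupport hc).eLpNorm_eq_integral_rpow_norm
      (by simp) (by simp)]
    simp [hNdef]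
  have hT : ∀ i j k, |∫ x, pd i (fun y => v y j) x * pd i (fun y => v y k) x
      * pd k (fun y => v y j) x| ≤ 2 * (C * N * L) := by
    intro i j k
    have b1 := hcore _ _ _ N L (g j) (g k) (g j) hN hL (hL3 j) (hlap k) (hlap j) i i k
    have b2 := hcore _ _ _ N L (g j) (g j) (g k) hN hL (hL3 j) (hlap j) (hlap k) k i i
    simp_rw [mul_assoc]
    rw [ibp (g j) (((g k).pd i).mul ((g j).pd k)) i, abs_neg]
    simp_rw [pd_mul ((g k).pd i) ((g j).pd k), mul_add]
    rw [integral_add ((g j).mul (((g k).pd i).mul (((g j).pd k).pd i))).integrable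
      ((g j).mul (((g j).pd k).mul (((g k).pd i).pd i))).integrable]
    refine (abs_add_le _ _).trans ?_
    rw [mul_assoc] at b1 b2
    linarith
  have hi : ∀ i j k, Integrable (fun x => pd i (fun y => v y j) x * pd i (fun y => v y k) x
      * pd k (fun y => v y j) x) := fun i j k =>
    ((((g j).pd i).mul ((g k).pd i)).mul ((g j).pd k)).integrable
  rw [integral_finsetSum _ fun i _ => integrable_finsetSum _ fun j _ =>
    integrable_finsetSum _ fun k _ => hi i j k]
  simp_rw [integral_finsetSum Finset.univ fun j (_ : j ∈ Finset.univ) =>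
    integrable_finsetSum Finset.univ fun k (_ : k ∈ Finset.univ) => hi _ j k]
  simp_rw [integral_finsetSum Finset.univ fun k (_ : k ∈ Finset.univ) => hi _ _ k]
  refine (neg_le_abs _).trans ?_
  have : ∑ i : Fin 3, ∑ j : Fin 3, ∑ k : Fin 3, 2 * (C * N * L) = 54 * C * N * L := by
    simp; ring
  rw [← this]
  refine (Finset.abs_sum_le_sum_abs _ _).trans (Finset.sum_le_sum fun i _ => ?_)
  refine (Finset.abs_sum_le_sum_abs _ _).trans (Finset.sum_le_sum fun j _ => ?_)
  exact (Finset.abs_sum_le_sum_abs _ _).trans (Finset.sum_le_sum fun k _ => hT i j k)
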